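/- arXiv:nlin/0612025 — 3 statements merged into one kernel-verified Lean document; each statement's English description precedes it below -/
import Mathlib

section
/- With the canonical bracket {F,G}_0 := Σ_i(∂F/∂μ_i ∂G/∂λ_i − ∂F/∂λ_i ∂G/∂μ_i) on smooth functions on U, for all real x, y one has {B(x), B(y)}_0 = 0 identically on U. -/
noncomputable section

/-- The open set `U ⊂ ℝ^{2n}` of points `(λ, μ)` with the `λ_i` pairwise distinct. -/
def U (n : ℕ) : Set ((Fin n → ℝ) × (Fin n → ℝ)) := {z | Function.Injective z.1}

/-- `A(x) := α ∏_{i=1}^n (x − λ_i)`. -/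
def Afun (n : ℕ) (α : ℝ) (x : ℝ) (z : (Fin n → ℝ) × (Fin n → ℝ)) : ℝ :=
  α * ∏ i, (x - z.1 i)

/-- `A'(λ_i)`, the derivative of the polynomial `A` at `λ_i`. -/
def Ader (n : ℕ) (α : ℝ) (z : (Fin n → ℝ) × (Fin n → ℝ)) (i : Fin n) : ℝ :=
  deriv (fun x => Afun n α x z) (z.1 i)

/-- The polynomial `A(x)/(x − λ_i) = α ∏_{j ≠ i} (x − λ_j)`. -/
def lagr (n : ℕ) (α : ℝ) (z : (Fin n → ℝ) × (Fin n → ℝ)) (i : Fin n) (x : ℝ) : ℝ :=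
  α * ∏ j ∈ Finset.univ.erase i, (x - z.1 j)

/-- `B(x) := A(x)(β/α + Σ_i e^{ημ_i}/((x−λ_i)A'(λ_i)))`, written with the polynomial
`A(x)/(x−λ_i)`, so `B` is a polynomial in `x`. -/
def Bfun (n : ℕ) (α β η : ℝ) (x : ℝ) (z : (Fin n → ℝ) × (Fin n → ℝ)) : ℝ :=
  (β / α) * Afun n α x z + ∑ i, Real.exp (η * z.2 i) * lagr n α z i x / Ader n α z i

/-- `C(x) := A(x)(γ/α − Σ_i d(λ_i)e^{−ημ_i}/((x−λ_i)A'(λ_i)))`, written with the polynomial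
`A(x)/(x−λ_i)`, so `C` is a polynomial in `x`. -/
def Cfun (n : ℕ) (α γ η : ℝ) (d : Polynomial ℝ) (x : ℝ)
    (z : (Fin n → ℝ) × (Fin n → ℝ)) : ℝ :=
  (γ / α) * Afun n α x z
    - ∑ i, d.eval (z.1 i) * Real.exp (-(η * z.2 i)) * lagr n α z i x / Ader n α z i

/-- Partial derivative of `F` with respect to `λ_i`. -/
def pdLam {n : ℕ} (F : (Fin n → ℝ) × (Fin n → ℝ) → ℝ) (i : Fin n)
    (z : (Fin n → ℝ) × (Fin n → ℝ)) : ℝ :=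
  fderiv ℝ F z (Pi.single i 1, 0)

/-- Partial derivative of `F` with respect to `μ_i`. -/
def pdMu {n : ℕ} (F : (Fin n → ℝ) × (Fin n → ℝ) → ℝ) (i : Fin n)
    (z : (Fin n → ℝ) × (Fin n → ℝ)) : ℝ :=
  fderiv ℝ F z (0, Pi.single i 1)

/-- The canonical bracket `{F,G}_0 := Σ_i (∂F/∂μ_i ∂G/∂λ_i − ∂F/∂λ_i ∂G/∂μ_i)`. -/
def bracket0 {n : ℕ} (F G : (Fin n → ℝ) × (Fin n → ℝ) → ℝ)
    (z : (Fin n → ℝ) × (Fin n → ℝ)) : ℝ :=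
  ∑ i, (pdMu F i z * pdLam G i z - pdLam F i z * pdMu G i z)

/-- `A'(λ_i) = α ∏_{j ≠ i} (λ_i − λ_j)`. -/
lemma Ader_eq_lagr (n : ℕ) (α : ℝ) (z : (Fin n → ℝ) × (Fin n → ℝ)) (i : Fin n) :
    Ader n α z i = lagr n α z i (z.1 i) := by
  have hA : (fun x => Afun n α x z) = fun x => (x - z.1 i) * lagr n α z i x := by
    funext x
    rw [Afun, lagr, ← Finset.mul_prod_erase Finset.univ (fun j => x - z.1 j) (Finset.mem_univ i)]
    ring
  have hl : DifferentiableAt ℝ (fun x => lagr n α z i x) (z.1 i) := by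
    unfold lagr; fun_prop
  have h := ((hasDerivAt_id' (z.1 i)).sub_const (z.1 i)).fun_mul hl.hasDerivAt
  rw [Ader, hA, h.deriv]
  simp

lemma lagr_self_ne_zero {n : ℕ} {α : ℝ} (hα : α ≠ 0) {z : (Fin n → ℝ) × (Fin n → ℝ)}
    (hz : z ∈ U n) (i : Fin n) : lagr n α z i (z.1 i) ≠ 0 := by
  refine mul_ne_zero hα (Finset.prod_ne_zero_iff.2 fun j hj => ?_)
  exact sub_ne_zero.2 fun h => (Finset.ne_of_mem_erase hj) (hz h).symm

lemma differentiableAt_Bfun {n : ℕ} {α : ℝ} (hα : α ≠ 0) (β η x : ℝ)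
    {z : (Fin n → ℝ) × (Fin n → ℝ)} (hz : z ∈ U n) :
    DifferentiableAt ℝ (fun w => Bfun n α β η x w) z := by
  simp only [Bfun, Ader_eq_lagr]
  refine DifferentiableAt.fun_add (by unfold Afun; fun_prop) (DifferentiableAt.fun_sum fun i _ => ?_)
  have hnum : DifferentiableAt ℝ (fun w : (Fin n → ℝ) × (Fin n → ℝ) =>
      Real.exp (η * w.2 i) * lagr n α w i x) z := by
    unfold lagr; fun_prop
  have hden : DifferentiableAt ℝ (fun w : (Fin n → ℝ) × (Fin n → ℝ) =>
      lagr n α w i (w.1 i)) z := by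
    unfold lagr; fun_prop
  simp only [div_eq_mul_inv]
  exact hnum.fun_mul (hden.fun_inv (lagr_self_ne_zero hα hz i))

/-- The `μ_k`-derivative of `B` is a multiple of `A(x)/(x − λ_k)`, by a factor free of `x`. -/
lemma exists_pdMu_Bfun_eq {n : ℕ} {α : ℝ} (hα : α ≠ 0) (β η : ℝ)
    {z : (Fin n → ℝ) × (Fin n → ℝ)} (hz : z ∈ U n) (k : Fin n) :
    ∃ c, ∀ x, pdMu (fun w => Bfun n α β η x w) k z = c * lagr n α z k x := by
  refine ⟨η * Real.exp (η * z.2 k) / Ader n α z k, fun x => ?_⟩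
  have hcurve : HasDerivAt (fun t : ℝ => (z.1, Function.update z.2 k t)) (0, Pi.single k 1)
      (z.2 k) := (hasDerivAt_const _ _).prodMk (hasDerivAt_update _ _ _)
  have hF := (differentiableAt_Bfun hα β η x hz).hasFDerivAt
  have h1 := hF.comp_hasDerivAt_of_eq (z.2 k) hcurve (by simp)
  have h2 : HasDerivAt (fun t : ℝ => Bfun n α β η x (z.1, Function.update z.2 k t))
      (0 + ∑ i, if i = k then
        η * Real.exp (η * z.2 k) / Ader n α z k * lagr n α z k x else 0) (z.2 k) := by
    refine (hasDerivAt_const _ (β / α * Afun n α x z)).fun_add (HasDerivAt.fun_sum fun i _ => ?_)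
    change HasDerivAt (fun t : ℝ => Real.exp (η * Function.update z.2 k t i) *
      lagr n α z i x / Ader n α z i) _ _
    split_ifs with hi
    · subst hi
      simp only [Function.update_self]
      refine HasDerivAt.congr_deriv (((((hasDerivAt_id' (z.2 i)).const_mul η).exp.mul_const
        (lagr n α z i x)).div_const (Ader n α z i))) ?_
      ring
    · simp only [Function.update_of_ne hi]
      exact hasDerivAt_const _ _
  rw [pdMu, h1.unique h2]
  simp

/-- The `λ_k`-derivative of a Lagrange basis polynomial is a multiple of `A(x)/(x − λ_k)`,
by a factor free of `x`. -/
lemma exists_hasDerivAt_lagr_div {n : ℕ} {α : ℝ} (hα : α ≠ 0)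
    {z : (Fin n → ℝ) × (Fin n → ℝ)} (hz : z ∈ U n) (k i : Fin n) :
    ∃ c, ∀ x, HasDerivAt (fun t : ℝ => lagr n α (Function.update z.1 k t, z.2) i x /
      lagr n α (Function.update z.1 k t, z.2) i (Function.update z.1 k t i))
      (c * lagr n α z k x) (z.1 k) := by
  by_cases hi : i = k
  · subst hi
    have hl : ∀ t x, lagr n α (Function.update z.1 i t, z.2) i x = lagr n α z i x := by
      intro t x
      unfold lagr
      congr 1
      refine Finset.prod_congr rfl fun j hj => ?_
      simp [Function.update_of_ne (Finset.ne_of_mem_erase hj)]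
    simp only [hl, Function.update_self]
    have hd : DifferentiableAt ℝ (fun t => (lagr n α z i t)⁻¹) (z.1 i) := by
      refine DifferentiableAt.fun_inv ?_ (lagr_self_ne_zero hα hz i)
      unfold lagr; fun_prop
    refine ⟨deriv (fun t => (lagr n α z i t)⁻¹) (z.1 i), fun x => ?_⟩
    simp only [div_eq_mul_inv, mul_comm (lagr n α z i x)]
    exact hd.hasDerivAt.mul_const _
  · set r : ℝ → ℝ := fun x => ∏ j ∈ (Finset.univ.erase i).erase k, (x - z.1 j) with hr
    have hl : ∀ t x, lagr n α (Function.update z.1 k t, z.2) i x = α * ((x - t) * r x) := by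
      intro t x
      rw [lagr, ← Finset.mul_prod_erase (Finset.univ.erase i) _
        (Finset.mem_erase.2 ⟨Ne.symm hi, Finset.mem_univ k⟩)]
      simp only [Function.update_self, hr]
      congr 2
      refine Finset.prod_congr rfl fun j hj => ?_
      simp [Function.update_of_ne (Finset.ne_of_mem_erase hj)]
    have hk : ∀ x, lagr n α z k x = α * ((x - z.1 i) * r x) := by
      intro x
      rw [lagr, ← Finset.mul_prod_erase (Finset.univ.erase k) _
        (Finset.mem_erase.2 ⟨hi, Finset.mem_univ i⟩), Finset.erase_right_comm]
    have hne : α * ((z.1 i - z.1 k) * r (z.1 i)) ≠ 0 := by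
      have h := lagr_self_ne_zero hα hz i
      have h' := hl (z.1 k) (z.1 i)
      rw [Function.update_eq_self] at h'
      rwa [← h']
    have hik : z.1 i - z.1 k ≠ 0 := fun h => hne (by simp [h])
    have hri : r (z.1 i) ≠ 0 := fun h => hne (by simp [h])
    refine ⟨1 / (α * (z.1 i - z.1 k) ^ 2 * r (z.1 i)), fun x => ?_⟩
    simp only [hl, Function.update_of_ne hi, hk]
    have hlin : ∀ a b : ℝ, HasDerivAt (fun t => α * ((a - t) * b)) (α * (-1 * b)) (z.1 k) :=
      fun a b => (((hasDerivAt_id' (z.1 k)).const_sub a).mul_const b).const_mul α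
    refine HasDerivAt.congr_deriv ((hlin x (r x)).fun_div (hlin (z.1 i) (r (z.1 i))) hne) ?_
    field_simp
    ring

/-- The `λ_k`-derivative of `B` is a multiple of `A(x)/(x − λ_k)`, by a factor free of `x`. -/
lemma exists_pdLam_Bfun_eq {n : ℕ} {α : ℝ} (hα : α ≠ 0) (β η : ℝ)
    {z : (Fin n → ℝ) × (Fin n → ℝ)} (hz : z ∈ U n) (k : Fin n) :
    ∃ c, ∀ x, pdLam (fun w => Bfun n α β η x w) k z = c * lagr n α z k x := by
  choose c hc using exists_hasDerivAt_lagr_div hα hz k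
  refine ⟨-(β / α) + ∑ i, Real.exp (η * z.2 i) * c i, fun x => ?_⟩
  have hcurve : HasDerivAt (fun t : ℝ => (Function.update z.1 k t, z.2)) (Pi.single k 1, 0)
      (z.1 k) := (hasDerivAt_update _ _ _).prodMk (hasDerivAt_const _ _)
  have hF := (differentiableAt_Bfun hα β η x hz).hasFDerivAt
  have h1 := hF.comp_hasDerivAt_of_eq (z.1 k) hcurve (by simp)
  have hA : HasDerivAt (fun t : ℝ => Afun n α x (Function.update z.1 k t, z.2))
      (-lagr n α z k x) (z.1 k) := by
    have hAt : ∀ t, Afun n α x (Function.update z.1 k t, z.2) = (x - t) * lagr n α z k x := by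
      intro t
      rw [Afun, ← Finset.mul_prod_erase Finset.univ _ (Finset.mem_univ k), lagr,
        Finset.prod_congr rfl (g := fun j => x - z.1 j) fun j hj => by
          simp [Function.update_of_ne (Finset.ne_of_mem_erase hj)]]
      simp only [Function.update_self]
      ring
    simp only [hAt]
    refine (((hasDerivAt_id' (z.1 k)).const_sub x).mul_const (lagr n α z k x)).congr_deriv ?_
    ring
  have h2 : HasDerivAt (fun t : ℝ => Bfun n α β η x (Function.update z.1 k t, z.2))
      (β / α * -lagr n α z k x + ∑ i, Real.exp (η * z.2 i) * (c i * lagr n α z k x))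
      (z.1 k) := by
    simp only [Bfun, Ader_eq_lagr, mul_div_assoc]
    exact (hA.const_mul _).fun_add (HasDerivAt.fun_sum fun i _ => (hc i x).const_mul _)
  rw [pdLam, h1.unique h2, add_mul, Finset.sum_mul]
  simp only [mul_assoc, neg_mul, mul_neg]

/-!
STATEMENT 5: {B(x), B(y)}_0 = 0 identically on U, for all real x, y.
-/
theorem sklyanin_BB (n : ℕ) (hn : 1 ≤ n) (α β η : ℝ) (hα : α ≠ 0)
    (x y : ℝ) (z : (Fin n → ℝ) × (Fin n → ℝ)) (hz : z ∈ U n) :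
    bracket0 (fun w => Bfun n α β η x w) (fun w => Bfun n α β η y w) z = 0 := by
  refine Finset.sum_eq_zero fun i _ => ?_
  obtain ⟨c, hc⟩ := exists_pdMu_Bfun_eq hα β η hz i
  obtain ⟨d, hd⟩ := exists_pdLam_Bfun_eq hα β η hz i
  rw [hc, hc, hd, hd]
  ring

end
end

section
/- For n ≥ 3, the periodic second Toda bracket {.,.}'_1 satisfies the Jacobi identity and is compatible with the canonical bracket: every linear combination a{.,.}_0 + b{.,.}'_1 with a, b ∈ ℝ satisfies the Jacobi identity. -/
noncomputable section

/-- Partial derivative of `F` with respect to `q_i` on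
`ℝ^{2n} = (Fin n → ℝ) × (Fin n → ℝ)`, coordinates `(q, p)`. -/
def pdQ {n : ℕ} (F : (Fin n → ℝ) × (Fin n → ℝ) → ℝ) (i : Fin n)
    (z : (Fin n → ℝ) × (Fin n → ℝ)) : ℝ :=
  fderiv ℝ F z (Pi.single i 1, 0)

/-- Partial derivative of `F` with respect to `p_i`. -/
def pdP {n : ℕ} (F : (Fin n → ℝ) × (Fin n → ℝ) → ℝ) (i : Fin n)
    (z : (Fin n → ℝ) × (Fin n → ℝ)) : ℝ :=
  fderiv ℝ F z (0, Pi.single i 1)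

/-- The canonical bracket `{F,G}_0 := Σ_i (∂F/∂q_i ∂G/∂p_i − ∂F/∂p_i ∂G/∂q_i)`. -/
def todaBr0 {n : ℕ} (F G : (Fin n → ℝ) × (Fin n → ℝ) → ℝ)
    (z : (Fin n → ℝ) × (Fin n → ℝ)) : ℝ :=
  ∑ i, (pdQ F i z * pdP G i z - pdP F i z * pdQ G i z)

/-- The periodic second Toda bracket `{.,.}'₁`: the biderivation with elementary brackets
`{q_j,q_i}'₁ = 1` for `i < j`, `{q_i,p_j}'₁ = p_i δ_{ij} − δ_{j1}e^{−q_1} − δ_{jn}e^{q_n}`,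
`{p_{i+1},p_i}'₁ = e^{q_i−q_{i+1}}` for `1 ≤ i ≤ n−1`, `{p_1,p_n}'₁ = e^{q_n−q_1}`,
and all remaining elementary brackets of coordinates zero.  (Indices are `0, …, n−1`
in Lean, so `p_1` is index `0` and `p_n` is index `n−1`.) -/
def perBr1 {n : ℕ} (F G : (Fin n → ℝ) × (Fin n → ℝ) → ℝ)
    (z : (Fin n → ℝ) × (Fin n → ℝ)) : ℝ :=
  (∑ i : Fin n, ∑ j : Fin n, if i < j then
      (pdQ F j z * pdQ G i z - pdQ F i z * pdQ G j z) else 0)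
  + (∑ i : Fin n, ∑ j : Fin n,
      ((if i = j then z.2 i else 0)
        - (if (j : ℕ) = 0 then Real.exp (-(z.1 j)) else 0)
        - (if (j : ℕ) = n - 1 then Real.exp (z.1 j) else 0))
      * (pdQ F i z * pdP G j z - pdP F j z * pdQ G i z))
  + (∑ i : Fin n, ∑ j : Fin n, if (i : ℕ) + 1 = (j : ℕ) then
      Real.exp (z.1 i - z.1 j) * (pdP F j z * pdP G i z - pdP F i z * pdP G j z) else 0)
  + (∑ i : Fin n, ∑ j : Fin n, if (i : ℕ) = 0 ∧ (j : ℕ) = n - 1 then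
      Real.exp (z.1 j - z.1 i) * (pdP F i z * pdP G j z - pdP F j z * pdP G i z) else 0)

/-- The pencil `a{.,.}_0 + b{.,.}'₁`. -/
def perPencil {n : ℕ} (a b : ℝ) (F G : (Fin n → ℝ) × (Fin n → ℝ) → ℝ)
    (z : (Fin n → ℝ) × (Fin n → ℝ)) : ℝ :=
  a * todaBr0 F G z + b * perBr1 F G z

section GeneralBracket

variable {E ι : Type*} [NormedAddCommGroup E] [NormedSpace ℝ E] [Fintype ι]

/-- The skew bracket with upper-triangular coefficients `U` in the frame `e`. -/
def skewBracket (e : ι → E) (U : ι → ι → E → ℝ) (F G : E → ℝ) (z : E) : ℝ :=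
  ∑ u, ∑ v, U u v z *
    (fderiv ℝ F z (e u) * fderiv ℝ G z (e v) - fderiv ℝ F z (e v) * fderiv ℝ G z (e u))

/-- The Hamiltonian vector of the covector `φ`. -/
def hamiltonianVector (e : ι → E) (W : ι → ι → ℝ) (φ : E →L[ℝ] ℝ) : E :=
  ∑ u, ∑ v, (W u v * φ (e v)) • e u

lemma hamiltonianVector_eq_sum (e : ι → E) (W : ι → ι → ℝ) (φ : E →L[ℝ] ℝ) :
    hamiltonianVector e W φ = ∑ w, φ (e w) • ∑ l, W l w • e l := by
  unfold hamiltonianVector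
  rw [Finset.sum_comm]
  simp only [Finset.smul_sum, smul_smul, mul_comm]

lemma sum_sub_swap_mul (U : ι → ι → ℝ) (f g : ι → ℝ) :
    ∑ u, ∑ v, (U u v - U v u) * (f u * g v)
      = ∑ u, ∑ v, U u v * (f u * g v - f v * g u) := by
  simp only [sub_mul, mul_sub, Finset.sum_sub_distrib]
  congr 1
  rw [Finset.sum_comm]

lemma apply_hamiltonianVector (e : ι → E) (U : ι → ι → ℝ) (φ ψ : E →L[ℝ] ℝ) :
    φ (hamiltonianVector e (fun u v => U u v - U v u) ψ)
      = ∑ u, ∑ v, U u v * (φ (e u) * ψ (e v) - φ (e v) * ψ (e u)) := by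
  rw [← sum_sub_swap_mul U (fun u => φ (e u)) (fun v => ψ (e v))]
  simp only [hamiltonianVector, map_sum, map_smul, smul_eq_mul]
  refine Finset.sum_congr rfl fun u _ => Finset.sum_congr rfl fun v _ => by ring

lemma hasFDerivAt_skewBracket_apply (e : ι → E) (U : ι → ι → E → ℝ)
    (U' : ι → ι → E → E →L[ℝ] ℝ) (hU : ∀ u v z, HasFDerivAt (U u v) (U' u v z) z)
    {F G : E → ℝ} (hF : ContDiff ℝ 2 F) (hG : ContDiff ℝ 2 G) (z ξ : E) :
    fderiv ℝ (skewBracket e U F G) z ξ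
      = (∑ u, ∑ v, (U' u v z ξ - U' v u z ξ) * (fderiv ℝ F z (e u) * fderiv ℝ G z (e v)))
        + fderiv ℝ (fderiv ℝ F) z ξ
            (hamiltonianVector e (fun u v => U u v z - U v u z) (fderiv ℝ G z))
        - fderiv ℝ (fderiv ℝ G) z ξ
            (hamiltonianVector e (fun u v => U u v z - U v u z) (fderiv ℝ F z)) := by
  have key : ∀ {K : E → ℝ}, ContDiff ℝ 2 K → ∀ x, HasFDerivAt (fun y => fderiv ℝ K y x)
      ((fderiv ℝ (fderiv ℝ K) z).flip x) z := by
    intro K hK x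
    have h1 : Differentiable ℝ (fderiv ℝ K) :=
      (hK.fderiv_right (m := 1) (by norm_num)).differentiable (by norm_num)
    have := (h1 z).hasFDerivAt.clm_apply (hasFDerivAt_const x z)
    simpa using this
  have hB : HasFDerivAt (skewBracket e U F G) _ z :=
    HasFDerivAt.fun_sum fun u _ => HasFDerivAt.fun_sum fun v _ => (hU u v z).mul
      (((key hF (e u)).mul (key hG (e v))).sub ((key hF (e v)).mul (key hG (e u))))
  rw [hB.fderiv, apply_hamiltonianVector, apply_hamiltonianVector, sum_sub_swap_mul
    (fun u v => U' u v z ξ) (fun u => fderiv ℝ F z (e u)) (fun u => fderiv ℝ G z (e u))]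
  simp only [sum_apply, ← Finset.sum_add_distrib, ← Finset.sum_sub_distrib]
  refine Finset.sum_congr rfl fun u _ => Finset.sum_congr rfl fun v _ => ?_
  simp
  ring

/-- A skew bracket satisfies the Jacobi identity if its coefficients do. -/
theorem skewBracket_jacobi (e : ι → E) (U : ι → ι → E → ℝ)
    (U' : ι → ι → E → E →L[ℝ] ℝ) (hU : ∀ u v z, HasFDerivAt (U u v) (U' u v z) z)
    {F G H : E → ℝ} (hF : ContDiff ℝ 2 F) (hG : ContDiff ℝ 2 G) (hH : ContDiff ℝ 2 H) (z : E)
    (hJ : ∀ u v w,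
      (U' u v z - U' v u z) (∑ l, (U l w z - U w l z) • e l)
      + (U' v w z - U' w v z) (∑ l, (U l u z - U u l z) • e l)
      + (U' w u z - U' u w z) (∑ l, (U l v z - U v l z) • e l) = 0) :
    skewBracket e U (skewBracket e U F G) H z
      + skewBracket e U (skewBracket e U G H) F z
      + skewBracket e U (skewBracket e U H F) G z = 0 := by
  have outer : ∀ K L : E → ℝ, skewBracket e U K L z = fderiv ℝ K z
      (hamiltonianVector e (fun u v => U u v z - U v u z) (fderiv ℝ L z)) := fun K L =>
    (apply_hamiltonianVector e (fun u v => U u v z) (fderiv ℝ K z) (fderiv ℝ L z)).symm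
  have symm : ∀ {K : E → ℝ}, ContDiff ℝ 2 K → ∀ x y, fderiv ℝ (fderiv ℝ K) z x y
      = fderiv ℝ (fderiv ℝ K) z y x := fun hK x y =>
    (hK.contDiffAt.isSymmSndFDerivAt (by simp)) x y
  rw [outer _ H, outer _ F, outer _ G, hasFDerivAt_skewBracket_apply e U U' hU hF hG,
    hasFDerivAt_skewBracket_apply e U U' hU hG hH, hasFDerivAt_skewBracket_apply e U U' hU hH hF]
  set f := fderiv ℝ F z
  set g := fderiv ℝ G z
  set h := fderiv ℝ H z
  set X := hamiltonianVector e (fun u v => U u v z - U v u z) with hX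
  have expand : ∀ (φ ψ χ : E →L[ℝ] ℝ),
      ∑ u, ∑ v, (U' u v z (X χ) - U' v u z (X χ)) * (φ (e u) * ψ (e v))
        = ∑ u, ∑ v, ∑ w, (U' u v z - U' v u z) (∑ l, (U l w z - U w l z) • e l)
            * (φ (e u) * ψ (e v) * χ (e w)) := by
    intro φ ψ χ
    refine Finset.sum_congr rfl fun u _ => Finset.sum_congr rfl fun v _ => ?_
    rw [← sub_apply, hX, hamiltonianVector_eq_sum, map_sum, Finset.sum_mul]
    refine Finset.sum_congr rfl fun w _ => ?_
    rw [map_smul, smul_eq_mul]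
    ring
  have rot : ∀ T : ι → ι → ι → ℝ, ∑ u, ∑ v, ∑ w, T u v w = ∑ u, ∑ v, ∑ w, T w u v := by
    intro T
    rw [Finset.sum_comm]
    exact Finset.sum_congr rfl fun _ _ => Finset.sum_comm
  have zero : (∑ u, ∑ v, (U' u v z (X h) - U' v u z (X h)) * (f (e u) * g (e v)))
      + (∑ u, ∑ v, (U' u v z (X f) - U' v u z (X f)) * (g (e u) * h (e v)))
      + (∑ u, ∑ v, (U' u v z (X g) - U' v u z (X g)) * (h (e u) * f (e v))) = 0 := by
    rw [expand, expand, expand, rot (fun u v w => _ * (h (e u) * f (e v) * g (e w))),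
      ← rot (fun u v w => (U' v w z - U' w v z) (∑ l, (U l u z - U u l z) • e l)
        * (g (e v) * h (e w) * f (e u)))]
    simp only [← Finset.sum_add_distrib]
    refine Finset.sum_eq_zero fun u _ => Finset.sum_eq_zero fun v _ =>
      Finset.sum_eq_zero fun w _ => ?_
    linear_combination (f (e u) * g (e v) * h (e w)) * hJ u v w
  linear_combination zero + symm hF (X h) (X g) + symm hG (X f) (X h) + symm hH (X g) (X f)

end GeneralBracket

section PeriodicToda

variable {n : ℕ}

/-- The coordinate frame of `ℝ^{2n}`. -/
def todaFrame (n : ℕ) : Fin n ⊕ Fin n → (Fin n → ℝ) × (Fin n → ℝ)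
  | .inl i => (Pi.single i 1, 0)
  | .inr i => (0, Pi.single i 1)

/-- Half of the structure functions of the pencil; the others follow by skew-symmetry. -/
def todaCoeff (a b : ℝ) : Fin n ⊕ Fin n → Fin n ⊕ Fin n → (Fin n → ℝ) × (Fin n → ℝ) → ℝ
  | .inl i, .inl j => fun _ => -(b * if i < j then 1 else 0)
  | .inl i, .inr j => fun z => (if i = j then 1 else 0) * (a + b * z.2 i)
      - b * ((if (j : ℕ) = 0 then 1 else 0) * Real.exp (-(z.1 j))
        + (if (j : ℕ) = n - 1 then 1 else 0) * Real.exp (z.1 j))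
  | .inr _, .inl _ => fun _ => 0
  | .inr i, .inr j => fun z =>
      b * ((if (i : ℕ) = 0 ∧ (j : ℕ) = n - 1 then 1 else 0) * Real.exp (z.1 j - z.1 i)
        - (if (i : ℕ) + 1 = (j : ℕ) then 1 else 0) * Real.exp (z.1 i - z.1 j))

/-- The coordinate function `q_i` as a continuous linear map. -/
def coordQ (i : Fin n) : (Fin n → ℝ) × (Fin n → ℝ) →L[ℝ] ℝ :=
  (ContinuousLinearMap.proj i).comp (ContinuousLinearMap.fst ℝ (Fin n → ℝ) (Fin n → ℝ))

/-- The coordinate function `p_i` as a continuous linear map. -/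
def coordP (i : Fin n) : (Fin n → ℝ) × (Fin n → ℝ) →L[ℝ] ℝ :=
  (ContinuousLinearMap.proj i).comp (ContinuousLinearMap.snd ℝ (Fin n → ℝ) (Fin n → ℝ))

/-- The differentials of the functions `todaCoeff`. -/
def todaCoeffDeriv (b : ℝ) : Fin n ⊕ Fin n → Fin n ⊕ Fin n → (Fin n → ℝ) × (Fin n → ℝ) →
    (Fin n → ℝ) × (Fin n → ℝ) →L[ℝ] ℝ
  | .inl _, .inl _ => fun _ => 0
  | .inl i, .inr j => fun z => (if i = j then 1 else 0 : ℝ) • b • coordP i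
      - b • ((if (j : ℕ) = 0 then 1 else 0 : ℝ) • Real.exp (-(z.1 j)) • (-coordQ j)
        + (if (j : ℕ) = n - 1 then 1 else 0 : ℝ) • Real.exp (z.1 j) • coordQ j)
  | .inr _, .inl _ => fun _ => 0
  | .inr i, .inr j => fun z =>
      b • ((if (i : ℕ) = 0 ∧ (j : ℕ) = n - 1 then 1 else 0 : ℝ) •
          Real.exp (z.1 j - z.1 i) • (coordQ j - coordQ i)
        - (if (i : ℕ) + 1 = (j : ℕ) then 1 else 0 : ℝ) •
          Real.exp (z.1 i - z.1 j) • (coordQ i - coordQ j))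

lemma hasFDerivAt_todaCoeff (a b : ℝ) (u v : Fin n ⊕ Fin n) (z : (Fin n → ℝ) × (Fin n → ℝ)) :
    HasFDerivAt (todaCoeff a b u v) (todaCoeffDeriv b u v z) z := by
  have hq : ∀ i : Fin n, HasFDerivAt (fun y : (Fin n → ℝ) × (Fin n → ℝ) => y.1 i) (coordQ i) z :=
    fun i => (coordQ i).hasFDerivAt
  have hp : ∀ i : Fin n, HasFDerivAt (fun y : (Fin n → ℝ) × (Fin n → ℝ) => y.2 i) (coordP i) z :=
    fun i => (coordP i).hasFDerivAt
  rcases u with i | i <;> rcases v with j | j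
  · exact hasFDerivAt_const _ z
  · exact ((((hp i).const_mul b).const_add a).const_mul _).sub
      ((((hq j).neg.exp.const_mul _).add ((hq j).exp.const_mul _)).const_mul b)
  · exact hasFDerivAt_const _ z
  · exact ((((hq j).sub (hq i)).exp.const_mul _).sub
      (((hq i).sub (hq j)).exp.const_mul _)).const_mul b

lemma coordQ_sum_smul_todaFrame (c : Fin n ⊕ Fin n → ℝ) (i : Fin n) :
    coordQ i (∑ l, c l • todaFrame n l) = c (.inl i) := by
  simp [coordQ, todaFrame, Pi.single_apply, Prod.fst_sum]

lemma coordP_sum_smul_todaFrame (c : Fin n ⊕ Fin n → ℝ) (i : Fin n) :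
    coordP i (∑ l, c l • todaFrame n l) = c (.inr i) := by
  simp [coordP, todaFrame, Pi.single_apply, Prod.snd_sum]

lemma perPencil_eq_skewBracket (a b : ℝ) (F G : (Fin n → ℝ) × (Fin n → ℝ) → ℝ) :
    perPencil a b F G = skewBracket (todaFrame n) (todaCoeff a b) F G := by
  funext z
  have h0 : todaBr0 F G z = ∑ i : Fin n, ∑ j : Fin n, (if i = j then 1 else 0) *
      (pdQ F i z * pdP G j z - pdP F j z * pdQ G i z) := by
    simp [todaBr0]
  rw [perPencil, h0, perBr1, skewBracket, Fintype.sum_sum_type]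
  simp only [Fintype.sum_sum_type, Finset.sum_add_distrib, mul_add, Finset.mul_sum]
  simp only [← Finset.sum_add_distrib]
  refine Finset.sum_congr rfl fun i _ => Finset.sum_congr rfl fun j _ => ?_
  simp only [todaCoeff, todaFrame, pdQ, pdP]
  split_ifs <;> subst_vars <;> ring

/-- The cyclic sum measuring the failure of the Jacobi identity on coordinate functions. -/
def todaJacobiator (a b : ℝ) (z : (Fin n → ℝ) × (Fin n → ℝ)) (u v w : Fin n ⊕ Fin n) : ℝ :=
  (todaCoeffDeriv b u v z - todaCoeffDeriv b v u z)
      (∑ l, (todaCoeff a b l w z - todaCoeff a b w l z) • todaFrame n l)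
    + (todaCoeffDeriv b v w z - todaCoeffDeriv b w v z)
      (∑ l, (todaCoeff a b l u z - todaCoeff a b u l z) • todaFrame n l)
    + (todaCoeffDeriv b w u z - todaCoeffDeriv b u w z)
      (∑ l, (todaCoeff a b l v z - todaCoeff a b v l z) • todaFrame n l)

lemma todaJacobiator_rotate (a b : ℝ) (z : (Fin n → ℝ) × (Fin n → ℝ)) (u v w : Fin n ⊕ Fin n) :
    todaJacobiator a b z u v w = todaJacobiator a b z v w u := by
  unfold todaJacobiator
  ring

lemma todaJacobiator_swap (a b : ℝ) (z : (Fin n → ℝ) × (Fin n → ℝ)) (u v w : Fin n ⊕ Fin n) :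
    todaJacobiator a b z u v w = -todaJacobiator a b z v u w := by
  simp only [todaJacobiator, sub_apply]
  ring

lemma todaJacobiator_qqq (a b : ℝ) (z : (Fin n → ℝ) × (Fin n → ℝ)) (i j k : Fin n) :
    todaJacobiator a b z (.inl i) (.inl j) (.inl k) = 0 := by
  simp [todaJacobiator, todaCoeffDeriv]

lemma todaJacobiator_qqp (a b : ℝ) (z : (Fin n → ℝ) × (Fin n → ℝ))
    (i j k : Fin n) : todaJacobiator a b z (.inl i) (.inl j) (.inr k) = 0 := by
  have key : ∀ i j : Fin n, i < j →
      todaJacobiator a b z (.inl i) (.inl j) (.inr k) = 0 := by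
    intro i j h
    simp only [todaJacobiator, todaCoeffDeriv, sub_apply, smul_apply, add_apply, neg_apply,
      zero_apply, coordQ_sum_smul_todaFrame, coordP_sum_smul_todaFrame, todaCoeff, smul_eq_mul]
    rw [Fin.lt_def] at h
    rcases lt_trichotomy k i with h1 | rfl | h1 <;> rcases lt_trichotomy k j with h2 | rfl | h2 <;>
      by_cases h0 : (k : ℕ) = 0 <;> by_cases hl : (k : ℕ) = n - 1 <;>
      simp only [Fin.lt_def, Fin.ext_iff] at * <;>
      first
      | (exfalso; omega)
      | (simp (disch := omega) only [if_true, if_pos, if_neg]; ring)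
  rcases lt_trichotomy i j with h | rfl | h
  · exact key i j h
  · linarith [todaJacobiator_swap a b z (.inl i) (.inl i) (.inr k)]
  · rw [todaJacobiator_swap, key j i h, neg_zero]

lemma todaJacobiator_qpp (hn : 3 ≤ n) (a b : ℝ) (z : (Fin n → ℝ) × (Fin n → ℝ))
    (i j k : Fin n) : todaJacobiator a b z (.inl i) (.inr j) (.inr k) = 0 := by
  have key : ∀ j k : Fin n, j < k →
      todaJacobiator a b z (.inl i) (.inr j) (.inr k) = 0 := by
    intro j k h
    simp only [todaJacobiator, todaCoeffDeriv, sub_apply, smul_apply, add_apply, neg_apply,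
      zero_apply, coordQ_sum_smul_todaFrame, coordP_sum_smul_todaFrame, todaCoeff, smul_eq_mul]
    have he : ∀ x y, Real.exp (x - y) = Real.exp x * Real.exp (-y) := fun x y => by
      rw [sub_eq_add_neg, Real.exp_add]
    simp only [he]
    have hj := j.isLt
    have hk := k.isLt
    have hi := i.isLt
    by_cases h0 : (j : ℕ) = 0 <;> by_cases hl : (k : ℕ) = n - 1 <;>
      by_cases h1 : (j : ℕ) + 1 = k <;>
      rcases lt_trichotomy i j with h2 | rfl | h2 <;> rcases lt_trichotomy i k with h3 | rfl | h3 <;>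
      simp only [Fin.lt_def, Fin.ext_iff] at * <;>
      first
      | (exfalso; omega)
      | (simp (disch := omega) only [if_true, if_pos, if_neg]; ring)
  rcases lt_trichotomy j k with h | rfl | h
  · exact key j k h
  · linarith [todaJacobiator_swap a b z (.inr j) (.inr j) (.inl i),
      todaJacobiator_rotate a b z (.inl i) (.inr j) (.inr j)]
  · rw [todaJacobiator_rotate, todaJacobiator_swap, ← todaJacobiator_rotate, key k j h, neg_zero]

lemma todaJacobiator_ppp (a b : ℝ) (z : (Fin n → ℝ) × (Fin n → ℝ)) (i j k : Fin n) :
    todaJacobiator a b z (.inr i) (.inr j) (.inr k) = 0 := by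
  have key : ∀ i k : Fin n, todaJacobiator a b z (.inr i) (.inr i) (.inr k) = 0 := fun i k => by
    linarith [todaJacobiator_swap a b z (.inr i) (.inr i) (.inr k)]
  by_cases hij : i = j
  · rw [hij, key]
  by_cases hjk : j = k
  · rw [hjk, todaJacobiator_rotate, key]
  by_cases hik : i = k
  · rw [hik, todaJacobiator_rotate, todaJacobiator_rotate, key]
  simp only [todaJacobiator, todaCoeffDeriv, sub_apply, smul_apply, coordQ_sum_smul_todaFrame,
    todaCoeff, smul_eq_mul, if_neg hij, if_neg hjk, if_neg hik, if_neg (Ne.symm hij),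
    if_neg (Ne.symm hjk), if_neg (Ne.symm hik)]
  ring

lemma todaJacobiator_eq_zero (hn : 3 ≤ n) (a b : ℝ) (z : (Fin n → ℝ) × (Fin n → ℝ))
    (u v w : Fin n ⊕ Fin n) : todaJacobiator a b z u v w = 0 := by
  rcases u with i | i <;> rcases v with j | j <;> rcases w with k | k
  · exact todaJacobiator_qqq a b z i j k
  · exact todaJacobiator_qqp a b z i j k
  · rw [todaJacobiator_rotate, todaJacobiator_rotate, todaJacobiator_qqp]
  · exact todaJacobiator_qpp hn a b z i j k
  · rw [todaJacobiator_rotate, todaJacobiator_qqp]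
  · rw [todaJacobiator_rotate, todaJacobiator_qpp hn]
  · rw [todaJacobiator_rotate, todaJacobiator_rotate, todaJacobiator_qpp hn]
  · exact todaJacobiator_ppp a b z i j k

end PeriodicToda

/-!
STATEMENT 13: for n ≥ 3, the periodic second Toda bracket {.,.}'₁ satisfies the Jacobi
identity and is compatible with the canonical bracket: every combination
a{.,.}_0 + b{.,.}'₁ satisfies the Jacobi identity.
-/
theorem periodic_toda_pencil_jacobi (n : ℕ) (hn : 3 ≤ n) (a b : ℝ)
    (F G H : (Fin n → ℝ) × (Fin n → ℝ) → ℝ)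
    (hF : ContDiff ℝ (⊤ : ℕ∞) F) (hG : ContDiff ℝ (⊤ : ℕ∞) G) (hH : ContDiff ℝ (⊤ : ℕ∞) H) :
    ∀ z, perPencil a b (perPencil a b F G) H z
      + perPencil a b (perPencil a b G H) F z
      + perPencil a b (perPencil a b H F) G z = 0 := by
  intro z
  simp only [perPencil_eq_skewBracket]
  exact skewBracket_jacobi (todaFrame n) (todaCoeff a b) (todaCoeffDeriv b)
    (hasFDerivAt_todaCoeff a b) (contDiff_infty.1 hF 2) (contDiff_infty.1 hG 2)
    (contDiff_infty.1 hH 2) z (todaJacobiator_eq_zero hn a b z)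

end
end

section
/- The first two integrals of the periodic Toda lattice, H_1 := −Σ_{i=1}^n p_i and H_2 := (1/2)Σ_{i=1}^n p_i^2 + Σ_{i=1}^{n} e^{q_i−q_{i+1}} − (1/2)(Σ_{i=1}^n p_i)^2 (indices mod n, i.e., q_{n+1} ≡ q_1), are in bi-involution: {H_1, H_2}_0 = 0 and {H_1, H_2}'_1 = 0. -/
noncomputable section

/-- The Toda Hamiltonian `H₂`, with the neighbour of the `i`-th particle given by `s i`. -/
def todaEnergy {n : ℕ} (s : Fin n → Fin n) (w : (Fin n → ℝ) × (Fin n → ℝ)) : ℝ :=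
  (1 / 2) * ∑ i, (w.2 i) ^ 2 + (∑ i, Real.exp (w.1 i - w.1 (s i))) - (1 / 2) * (∑ i, w.2 i) ^ 2

theorem hasFDerivAt_snd_apply {n : ℕ} (i : Fin n) (z : (Fin n → ℝ) × (Fin n → ℝ)) :
    HasFDerivAt (fun w : (Fin n → ℝ) × (Fin n → ℝ) => w.2 i)
      ((ContinuousLinearMap.proj i).comp (ContinuousLinearMap.snd ℝ (Fin n → ℝ) (Fin n → ℝ))) z :=
  ((ContinuousLinearMap.proj (R := ℝ) (φ := fun _ : Fin n => ℝ) i).comp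
    (ContinuousLinearMap.snd ℝ (Fin n → ℝ) (Fin n → ℝ))).hasFDerivAt

theorem hasFDerivAt_fst_apply {n : ℕ} (i : Fin n) (z : (Fin n → ℝ) × (Fin n → ℝ)) :
    HasFDerivAt (fun w : (Fin n → ℝ) × (Fin n → ℝ) => w.1 i)
      ((ContinuousLinearMap.proj i).comp (ContinuousLinearMap.fst ℝ (Fin n → ℝ) (Fin n → ℝ))) z :=
  ((ContinuousLinearMap.proj (R := ℝ) (φ := fun _ : Fin n => ℝ) i).comp
    (ContinuousLinearMap.fst ℝ (Fin n → ℝ) (Fin n → ℝ))).hasFDerivAt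

theorem fderiv_neg_sum_snd_apply {n : ℕ} (z v : (Fin n → ℝ) × (Fin n → ℝ)) :
    fderiv ℝ (fun w : (Fin n → ℝ) × (Fin n → ℝ) => -∑ i, w.2 i) z v = -∑ i, v.2 i := by
  have h := (HasFDerivAt.fun_sum (u := Finset.univ)
    fun (i : Fin n) _ => hasFDerivAt_snd_apply i z).fun_neg
  rw [h.fderiv]
  simp

theorem fderiv_todaEnergy_apply {n : ℕ} (s : Fin n → Fin n) (z v : (Fin n → ℝ) × (Fin n → ℝ)) :
    fderiv ℝ (todaEnergy s) z v =
      ∑ i, z.2 i * v.2 i + ∑ i, Real.exp (z.1 i - z.1 (s i)) * (v.1 i - v.1 (s i))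
        - (∑ i, z.2 i) * ∑ i, v.2 i := by
  have h1 := (HasFDerivAt.fun_sum (u := Finset.univ)
    fun (i : Fin n) _ => (hasFDerivAt_snd_apply i z).pow 2).const_mul (1 / 2 : ℝ)
  have h2 := HasFDerivAt.fun_sum (u := Finset.univ) fun (i : Fin n) _ =>
    ((hasFDerivAt_fst_apply i z).fun_sub (hasFDerivAt_fst_apply (s i) z)).exp
  have h3 := ((HasFDerivAt.fun_sum (u := Finset.univ)
    fun (i : Fin n) _ => hasFDerivAt_snd_apply i z).pow 2).const_mul (1 / 2 : ℝ)
  have h : HasFDerivAt (todaEnergy s) _ z := (h1.fun_add h2).fun_sub h3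
  rw [h.fderiv]
  simp [mul_assoc, ← Finset.mul_sum]

theorem pdQ_neg_sum_snd {n : ℕ} (k : Fin n) (z : (Fin n → ℝ) × (Fin n → ℝ)) :
    pdQ (fun w : (Fin n → ℝ) × (Fin n → ℝ) => -∑ i, w.2 i) k z = 0 := by
  rw [pdQ, fderiv_neg_sum_snd_apply]
  simp

theorem pdP_neg_sum_snd {n : ℕ} (k : Fin n) (z : (Fin n → ℝ) × (Fin n → ℝ)) :
    pdP (fun w : (Fin n → ℝ) × (Fin n → ℝ) => -∑ i, w.2 i) k z = -1 := by
  rw [pdP, fderiv_neg_sum_snd_apply]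
  simp

theorem pdP_todaEnergy {n : ℕ} (s : Fin n → Fin n) (k : Fin n)
    (z : (Fin n → ℝ) × (Fin n → ℝ)) :
    pdP (todaEnergy s) k z = z.2 k - ∑ i, z.2 i := by
  simp [pdP, fderiv_todaEnergy_apply, Pi.single_apply]

theorem sum_mul_pdQ_todaEnergy {n : ℕ} (s : Fin n → Fin n) (a : Fin n → ℝ)
    (z : (Fin n → ℝ) × (Fin n → ℝ)) :
    ∑ k, a k * pdQ (todaEnergy s) k z =
      ∑ i, Real.exp (z.1 i - z.1 (s i)) * (a i - a (s i)) := by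
  simp only [pdQ, fderiv_todaEnergy_apply, Pi.zero_apply, mul_zero, Finset.sum_const_zero,
    zero_add, sub_zero, Finset.mul_sum]
  rw [Finset.sum_comm]
  refine Finset.sum_congr rfl fun i _ => ?_
  simp only [Pi.single_apply, mul_sub, Finset.sum_sub_distrib, mul_ite, mul_one, mul_zero,
    Finset.sum_ite_eq, Finset.mem_univ, if_true]
  ring

theorem sum_pdQ_todaEnergy {n : ℕ} (s : Fin n → Fin n) (z : (Fin n → ℝ) × (Fin n → ℝ)) :
    ∑ k, pdQ (todaEnergy s) k z = 0 := by
  simpa using sum_mul_pdQ_todaEnergy s (fun _ => 1) z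

/-- A sum over the edges of the `n`-cycle splits into the path `0, …, n - 1` and the closing
edge. -/
theorem sum_path_add_sum_closing_edge {n : ℕ} (hn : 2 ≤ n) (s : Fin n → Fin n)
    (hs : ∀ i, (s i : ℕ) = ((i : ℕ) + 1) % n) (f : Fin n → Fin n → ℝ) :
    (∑ i : Fin n, ∑ j : Fin n, if (i : ℕ) + 1 = (j : ℕ) then f i j else 0)
      + (∑ i : Fin n, ∑ j : Fin n, if (i : ℕ) = 0 ∧ (j : ℕ) = n - 1 then f j i else 0)
      = ∑ i, f i (s i) := by
  rw [Finset.sum_comm (f := fun i j : Fin n =>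
    if (i : ℕ) = 0 ∧ (j : ℕ) = n - 1 then f j i else 0), ← Finset.sum_add_distrib]
  refine Finset.sum_congr rfl fun i _ => ?_
  rw [← Finset.sum_add_distrib, ← Finset.sum_ite_eq' Finset.univ (s i) (f i) |>.trans
    (if_pos (Finset.mem_univ _))]
  refine Finset.sum_congr rfl fun j _ => ?_
  have hj : j = s i ↔ (i : ℕ) + 1 = j ∨ ((j : ℕ) = 0 ∧ (i : ℕ) = n - 1) := by
    rw [Fin.ext_iff, hs]
    have := i.isLt
    have := j.isLt
    rcases Nat.lt_or_ge ((i : ℕ) + 1) n with h | h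
    · rw [Nat.mod_eq_of_lt h]
      omega
    · have : (i : ℕ) + 1 = n := by omega
      rw [this, Nat.mod_self]
      omega
  by_cases h1 : (i : ℕ) + 1 = j
  · have h2 : ¬((j : ℕ) = 0 ∧ (i : ℕ) = n - 1) := by omega
    simp only [hj, h1, h2, or_false, if_true, if_false, add_zero]
  · simp only [hj, h1, false_or, if_false, zero_add]

theorem todaBr0_neg_sum_snd_todaEnergy {n : ℕ} (s : Fin n → Fin n)
    (z : (Fin n → ℝ) × (Fin n → ℝ)) :
    todaBr0 (fun w => -∑ i, w.2 i) (todaEnergy s) z = 0 := by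
  simp [todaBr0, pdQ_neg_sum_snd, pdP_neg_sum_snd, sum_pdQ_todaEnergy]

theorem perBr1_neg_sum_snd_todaEnergy {n : ℕ} (hn : 2 ≤ n) (s : Fin n → Fin n)
    (hs : ∀ i, (s i : ℕ) = ((i : ℕ) + 1) % n) (z : (Fin n → ℝ) × (Fin n → ℝ)) :
    perBr1 (fun w => -∑ i, w.2 i) (todaEnergy s) z = 0 := by
  have hqp : (∑ i : Fin n, ∑ j : Fin n,
      ((if i = j then z.2 i else 0) - (if (j : ℕ) = 0 then Real.exp (-(z.1 j)) else 0)
        - (if (j : ℕ) = n - 1 then Real.exp (z.1 j) else 0)) * pdQ (todaEnergy s) i z)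
      = ∑ i, Real.exp (z.1 i - z.1 (s i)) * (z.2 i - z.2 (s i)) := by
    simp only [← Finset.sum_mul, Finset.sum_sub_distrib, Finset.sum_ite_eq, Finset.mem_univ,
      if_true, sum_mul_pdQ_todaEnergy]
    simp
  have hpp := sum_path_add_sum_closing_edge hn s hs
    fun i j => Real.exp (z.1 i - z.1 j) * (z.2 j - z.2 i)
  simp only [perBr1, pdQ_neg_sum_snd, pdP_neg_sum_snd, pdP_todaEnergy, zero_mul, sub_zero,
    ite_self, Finset.sum_const_zero, zero_add, zero_sub, neg_mul, one_mul, neg_neg]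
  have hpath : ∀ a b S : ℝ, -(a - S) - -(b - S) = b - a := fun a b S => by ring
  simp only [hpath]
  rw [hqp, add_assoc, hpp, ← Finset.sum_add_distrib]
  exact Finset.sum_eq_zero fun i _ => by ring

/-!
STATEMENT 14: the first two periodic Toda integrals
H₁ = −Σ p_i and H₂ = (1/2)Σ p_i² + Σ_{i=1}^n e^{q_i−q_{i+1}} − (1/2)(Σ p_i)²
(indices mod n, q_{n+1} ≡ q_1) are in bi-involution: {H₁,H₂}_0 = 0 and {H₁,H₂}'₁ = 0.
-/
theorem periodic_toda_bi_involution (n : ℕ) (hn : 3 ≤ n)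
    (H1 H2 : (Fin n → ℝ) × (Fin n → ℝ) → ℝ)
    (hH1 : H1 = fun w => -∑ i, w.2 i)
    (hH2 : H2 = fun w => (1 / 2) * ∑ i, (w.2 i) ^ 2 +
      (∑ i : Fin n, Real.exp (w.1 i - w.1 (⟨((i : ℕ) + 1) % n, Nat.mod_lt _ (by omega)⟩ : Fin n))) -
      (1 / 2) * (∑ i, w.2 i) ^ 2) :
    (∀ z, todaBr0 H1 H2 z = 0) ∧ (∀ z, perBr1 H1 H2 z = 0) := by
  subst hH1 hH2
  exact ⟨todaBr0_neg_sum_snd_todaEnergy _,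
    perBr1_neg_sum_snd_todaEnergy (by omega) _ fun _ => rfl⟩

end
end
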